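/- Let |P| ≥ 3 and let L = ⟨z_p + z_q : p ≠ q ∈ P⟩ + ⟨Σ_{s∈P} x_s⟩ be the GHZ Lagrangian, with the standard section σ so that C(L,σ) is spanned by the GHZ state |0⋯0⟩ + |1⋯1⟩. Then the full automorphism group A(L,σ) is generated by the element of SO(3)^P all of whose components are the rotation by 180° about the x-axis, together with the torus {(g_s)_{s∈P} ∈ (C_z)^P : Π_{s∈P} g_s = 1}. Similarly, for L' = ⟨z_p + z_q : p ≠ q ∈ P⟩ with standard section σ' (so that C(L',σ') = ⟨|0⋯0⟩, |1⋯1⟩⟩), the full automorphism group A(L',σ') is generated by the simultaneous 180° x-rotation together with the full torus (C_z)^P. -/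

import Mathlib

/- Common framework: binary stabilizer codes, local unitary/SO(3) automorphism groups. -/

noncomputable section
open scoped Matrix Real ComplexConjugate
open scoped Classical

namespace Stab

/-- The one-qubit phase space `V = 𝔽₂ ⊕ 𝔽₂`, with first coordinate the `z`-component
and second coordinate the `x`-component. -/
abbrev V : Type := ZMod 2 × ZMod 2

/-- The symplectic form on `V`. -/
def omegaV (u v : V) : ZMod 2 := u.1 * v.2 + u.2 * v.1

/-- The phase space `V^P` over a set of qubits `P`. -/
abbrev QV (P : Type) := P → V

variable {P : Type} [Fintype P] [DecidableEq P]

/-- The direct-sum symplectic form on `V^P`. -/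
def omega (u v : QV P) : ZMod 2 := ∑ p, omegaV (u p) (v p)

/-- A subspace `L ⊆ V^P` is isotropic if `ω` vanishes identically on `L × L`. -/
def Isotropic (L : Submodule (ZMod 2) (QV P)) : Prop := ∀ u ∈ L, ∀ v ∈ L, omega u v = 0

/-- Support of a vector of `V^P`. -/
def supp (v : QV P) : Set P := {p | v p ≠ 0}

/-- The basis vector `z_p`. -/
def zvec (p : P) : QV P := Pi.single p ((1 : ZMod 2), (0 : ZMod 2))

/-- The basis vector `x_p`. -/
def xvec (p : P) : QV P := Pi.single p ((0 : ZMod 2), (1 : ZMod 2))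

/-- Restriction (coordinate projection) of a vector to a subset `S ⊆ P`. -/
def restrTo (S : Set P) (v : QV P) : QV P := fun p => if p ∈ S then v p else 0

/-- The coordinate subspace `V^S ⊆ V^P`. -/
def coordSub (S : Set P) : Submodule (ZMod 2) (QV P) where
  carrier := {v | ∀ p ∉ S, v p = 0}
  add_mem' := by intro a b ha hb p hp; simp [Pi.add_apply, ha p hp, hb p hp]
  zero_mem' := by intro p _; rfl
  smul_mem' := by intro c a ha p hp; simp [Pi.smul_apply, ha p hp]

/-- `L_S := L ∩ V^S`. -/
def LS (L : Submodule (ZMod 2) (QV P)) (S : Set P) : Submodule (ZMod 2) (QV P) :=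
  L ⊓ coordSub S

/-- `L` splits as a direct factor on `S`, i.e. `L = L_S × L_{P∖S}`. -/
def SplitsOn (L : Submodule (ZMod 2) (QV P)) (S : Set P) : Prop :=
  ∀ v ∈ L, restrTo S v ∈ L

/-- `L` splits off a zero factor: on some nonempty `S ⊆ P` all vectors of `L` vanish. -/
def HasZeroFactor (L : Submodule (ZMod 2) (QV P)) : Prop :=
  ∃ S : Set P, S.Nonempty ∧ ∀ v ∈ L, ∀ p ∈ S, v p = 0

/-- The qubit `p` is trivial: `L` splits off a one-dimensional factor on `{p}`. -/
def TrivialQubit (L : Submodule (ZMod 2) (QV P)) (p : P) : Prop :=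
  SplitsOn L {p} ∧ ∃ v ∈ L, v ≠ 0 ∧ supp v ⊆ {p}

/-- `L` splits off a trivial factor. -/
def HasTrivialFactor (L : Submodule (ZMod 2) (QV P)) : Prop :=
  ∃ p : P, TrivialQubit L p

/-- `L` splits off a Bell Lagrangian: an indecomposable Lagrangian direct factor on a
two-element set of qubits (all of whose nonzero vectors have full support `{p, q}`). -/
def HasBellFactor (L : Submodule (ZMod 2) (QV P)) : Prop :=
  ∃ p q : P, p ≠ q ∧ SplitsOn L {p, q} ∧
    ∃ v ∈ L, ∃ w ∈ L, v ≠ w ∧ supp v = {p, q} ∧ supp w = {p, q} ∧ supp (v + w) = {p, q}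

/-- The factor `L_S` (for `S` in a partition) is indecomposable. -/
def IndecompWithin (L : Submodule (ZMod 2) (QV P)) (S : Set P) : Prop :=
  ∀ T ⊆ S, SplitsOn L T → T = ∅ ∨ T = S

/-! ### The Hilbert space, Pauli operators and stabilizer codes -/

/-- The state space `ℋ^{⊗P} = (ℂ²)^{⊗P}`, realised concretely as functions on
computational basis labels. -/
abbrev HP (P : Type) := (P → Fin 2) → ℂ

/-- Operators on `ℋ^{⊗P}` as matrices. -/
abbrev MatP (P : Type) := Matrix (P → Fin 2) (P → Fin 2) ℂ

/-- The tensor (local) operator `⊗_{p} g_p` on `ℋ^{⊗P}`. -/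
def locOp (g : P → Matrix (Fin 2) (Fin 2) ℂ) : MatP P :=
  Matrix.of fun u w => ∏ p, g p (u p) (w p)

def sigmaX : Matrix (Fin 2) (Fin 2) ℂ := !![0, 1; 1, 0]
def sigmaY : Matrix (Fin 2) (Fin 2) ℂ := !![0, -Complex.I; Complex.I, 0]
def sigmaZ : Matrix (Fin 2) (Fin 2) ℂ := !![1, 0; 0, -1]

/-- The one-qubit Pauli operator `Z^a X^b` attached to `(a, b) ∈ V`. -/
def pauliMat (v : V) : Matrix (Fin 2) (Fin 2) ℂ := sigmaZ ^ (v.1 : ZMod 2).val * sigmaX ^ (v.2 : ZMod 2).val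

/-- The Pauli (Weyl) operator attached to `v ∈ V^P`. -/
def Wop (v : QV P) : MatP P := locOp fun p => pauliMat (v p)

/-- A group-homomorphic section `σ` over `L` of the projection from the Pauli group
`Ṽ^P` onto `V^P`: each value `σ(v)` is a unitary scalar multiple of the Pauli operator
`W(v)`, and `σ` is multiplicative on `L`. -/
structure PauliSection (L : Submodule (ZMod 2) (QV P)) where
  toFun : QV P → MatP P
  scalar : ∀ v : QV P, ∃ c : ℂ, toFun v = c • Wop v
  unitary : ∀ v : QV P, toFun v ∈ Matrix.unitaryGroup (P → Fin 2) ℂ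
  mul_of_mem : ∀ u ∈ L, ∀ v ∈ L, toFun (u + v) = toFun u * toFun v
  map_zero : toFun 0 = 1

/-- The stabilizer code `C(L, σ)`: the common fixed-point space of the stabilizer
group `σ(L)`. -/
def code (L : Submodule (ZMod 2) (QV P)) (σ : PauliSection L) : Submodule ℂ (HP P) where
  carrier := {ψ | ∀ v ∈ L, σ.toFun v *ᵥ ψ = ψ}
  add_mem' := by intro a b ha hb v hv; rw [Matrix.mulVec_add, ha v hv, hb v hv]
  zero_mem' := by intro v hv; simp
  smul_mem' := by intro c a ha v hv; rw [Matrix.mulVec_smul, ha v hv]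

/-- The standard section: `σ(v) = W(v)` on `L`. -/
def StandardOn (L : Submodule (ZMod 2) (QV P)) (σ : PauliSection L) : Prop :=
  ∀ v ∈ L, σ.toFun v = Wop v

/-! ### `SO(3)`, rotations, and the automorphism group of a code -/

/-- `3×3` real matrices. -/
abbrev Rot : Type := Matrix (Fin 3) (Fin 3) ℝ

/-- `SO(3)` as a set of `3×3` real matrices. -/
def SO3 : Set Rot := {A | A * Aᵀ = 1 ∧ A.det = 1}

/-- The ordered Pauli basis (x, y, z) of traceless Hermitian `2×2` matrices. -/
def pauliBasis : Fin 3 → Matrix (Fin 2) (Fin 2) ℂ := ![sigmaX, sigmaY, sigmaZ]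

/-- The image of a unitary `u ∈ U(2)` in `SO(3)` under the adjoint action on traceless
Hermitian operators (the identification `U(2)/S¹ = SO(3)`):
`u σ_j u† = Σ_i (adjRot u)_{ij} σ_i`. -/
def adjRot (u : Matrix (Fin 2) (Fin 2) ℂ) : Rot :=
  Matrix.of fun i j =>
    (1 / 2 : ℝ) * ((pauliBasis i * u * pauliBasis j * u.conjTranspose).trace).re

/-- Rotation about the `x`-axis by angle `θ`. -/
def rotX (θ : ℝ) : Rot := !![1, 0, 0; 0, Real.cos θ, -Real.sin θ; 0, Real.sin θ, Real.cos θ]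

/-- Rotation about the `y`-axis by angle `θ`. -/
def rotY (θ : ℝ) : Rot := !![Real.cos θ, 0, Real.sin θ; 0, 1, 0; -Real.sin θ, 0, Real.cos θ]

/-- Rotation about the `z`-axis by angle `θ`. -/
def rotZ (θ : ℝ) : Rot := !![Real.cos θ, -Real.sin θ, 0; Real.sin θ, Real.cos θ, 0; 0, 0, 1]

/-- The circle group `C_x ⊆ SO(3)` of rotations about the `x`-axis. -/
def Cx : Set Rot := Set.range rotX

/-- The circle group `C_y ⊆ SO(3)` of rotations about the `y`-axis. -/
def Cy : Set Rot := Set.range rotY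

/-- The circle group `C_z ⊆ SO(3)` of rotations about the `z`-axis. -/
def Cz : Set Rot := Set.range rotZ

/-- The octahedral group: the subgroup of `SO(3)` generated by the rotations by a right
angle about the three coordinate axes. -/
def octahedral : Set Rot :=
  (Submonoid.closure {rotX (π / 2), rotY (π / 2), rotZ (π / 2)} : Submonoid Rot)

/-- The infinite dihedral group `D_x ⊆ SO(3)`. -/
def Dx : Set Rot := (Submonoid.closure (Cx ∪ {rotZ π}) : Submonoid Rot)

/-- The infinite dihedral group `D_y ⊆ SO(3)`. -/
def Dy : Set Rot := (Submonoid.closure (Cy ∪ {rotZ π}) : Submonoid Rot)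

/-- The infinite dihedral group `D_z ⊆ SO(3)`. -/
def Dz : Set Rot := (Submonoid.closure (Cz ∪ {rotX π}) : Submonoid Rot)

/-- The automorphism group `A(L, σ) ⊆ SO(3)^P` of the stabilizer code `C(L, σ)`:
all families of rotations admitting a local unitary lift mapping the code into itself. -/
def autSet (L : Submodule (ZMod 2) (QV P)) (σ : PauliSection L) : Set (P → Rot) :=
  {g | ∃ u : P → Matrix (Fin 2) (Fin 2) ℂ,
        (∀ p, u p ∈ Matrix.unitaryGroup (Fin 2) ℂ) ∧
        (∀ p, adjRot (u p) = g p) ∧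
        ∀ ψ ∈ code L σ, locOp u *ᵥ ψ ∈ code L σ}

/-- The automorphism group `A(L, σ)_p` at the qubit `p`. -/
def autSetAt (L : Submodule (ZMod 2) (QV P)) (σ : PauliSection L) (p : P) : Set Rot :=
  (fun g => g p) '' autSet L σ

/-- The normal subgroup `Z(L, σ)` of automorphisms acting by a scalar on the code. -/
def zSet (L : Submodule (ZMod 2) (QV P)) (σ : PauliSection L) : Set (P → Rot) :=
  {g | ∃ u : P → Matrix (Fin 2) (Fin 2) ℂ,
        (∀ p, u p ∈ Matrix.unitaryGroup (Fin 2) ℂ) ∧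
        (∀ p, adjRot (u p) = g p) ∧
        ∃ c : ℂ, ∀ ψ ∈ code L σ, locOp u *ᵥ ψ = c • ψ}

/-! ### Restriction to subsets of qubits -/

/-- Restriction of a phase-space vector to the qubits of `S`. -/
def resQV (S : Set P) (v : QV P) : QV ↥S := fun s => v s

/-- Restriction as a linear map. -/
def resLin (S : Set P) : QV P →ₗ[ZMod 2] QV ↥S where
  toFun := resQV S
  map_add' := by intros; rfl
  map_smul' := by intros; rfl

/-- `L_S`, regarded as a subspace of `V^S`. -/
def LSsub (L : Submodule (ZMod 2) (QV P)) (S : Set P) : Submodule (ZMod 2) (QV ↥S) :=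
  Submodule.map (resLin S) (LS L S)

/-- The extension `M ⊗ 1` to `ℋ^{⊗P}` of an operator `M` on `ℋ^{⊗S}`. -/
def extendOp (S : Set P) (M : Matrix (↥S → Fin 2) (↥S → Fin 2) ℂ) : MatP P :=
  Matrix.of fun u w =>
    if ∀ p ∉ S, u p = w p then M (fun s => u s) (fun s => w s) else 0

/-- `σ'` is the restriction `σ|_{L_S}` of the section `σ` to `L_S`. -/
def RestrictedSection (L : Submodule (ZMod 2) (QV P)) (σ : PauliSection L) (S : Set P)
    (σ' : PauliSection (LSsub L S)) : Prop :=
  ∀ v ∈ LS L S, extendOp S (σ'.toFun (resQV S v)) = σ.toFun v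

/-! ### Contiguity, protected and gauge qubits, and normal forms -/

/-- Two qubits are contiguous if they are equal or `L` contains a vector supported
exactly on the pair. -/
def Contig (L : Submodule (ZMod 2) (QV P)) (p q : P) : Prop :=
  p = q ∨ ∃ v ∈ L, supp v = ({p, q} : Set P)

/-- The contiguity class of a qubit. -/
def contigClass (L : Submodule (ZMod 2) (QV P)) (p : P) : Set P := {q | Contig L p q}

/-- The qubit `p` is protected: the projection `L → V^{{p}}` is surjective. -/
def IsProtected (L : Submodule (ZMod 2) (QV P)) (p : P) : Prop :=
  ∀ w : V, ∃ v ∈ L, v p = w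

/-- The qubit `p` is of gauge type: the projection `L → V^{{p}}` has a line as image. -/
def IsGauge (L : Submodule (ZMod 2) (QV P)) (p : P) : Prop :=
  ¬ IsProtected L p ∧ ∃ v ∈ L, v p ≠ 0

/-- The subspace `⟨z_a + z_b : a ≠ b ∈ S⟩`. -/
def zspan (S : Set P) : Submodule (ZMod 2) (QV P) :=
  Submodule.span (ZMod 2) {w | ∃ a ∈ S, ∃ b ∈ S, a ≠ b ∧ w = zvec a + zvec b}

/-- The vector `Σ_{s ∈ S} x_s`. -/
def xsumOn (S : Set P) : QV P := S.indicator fun _ => ((0 : ZMod 2), (1 : ZMod 2))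

/-- Normal form of `L` (conclusion of the normalisation lemma): every contiguity class `S`
carries either `⟨z_a + z_b⟩` or `⟨z_a + z_b⟩ + ⟨Σ_{s∈S} x_s⟩`. -/
def NormalForm (L : Submodule (ZMod 2) (QV P)) : Prop :=
  ∀ p : P,
    LS L (contigClass L p) = zspan (contigClass L p) ∨
    LS L (contigClass L p) =
      zspan (contigClass L p) ⊔ Submodule.span (ZMod 2) {xsumOn (contigClass L p)}

/-- The pair `(L, σ)` is normalised. -/
def Normalised (L : Submodule (ZMod 2) (QV P)) (σ : PauliSection L) : Prop :=
  NormalForm L ∧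
  (∀ p : P, IsGauge L p → contigClass L p = {p} → ∀ v ∈ L, (v p).2 = 0) ∧
  (∀ p : P, IsProtected L p → contigClass L p = {p} →
    connectedComponentIn (autSetAt L σ p) 1 ⊆ Cz) ∧
  (∀ p : P, IsProtected L p → contigClass L p ≠ {p} →
    LS L (contigClass L p) = zspan (contigClass L p) →
    ∃ v ∈ L, ∀ s ∈ contigClass L p, v s = ((0 : ZMod 2), (1 : ZMod 2))) ∧
  (∀ p q : P, p ≠ q → Contig L p q →
    σ.toFun (zvec p + zvec q) = Wop (zvec p + zvec q))

/-- A local symplectic family of automorphisms of `V`. -/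
def IsLocalSymp (f : P → (V ≃ₗ[ZMod 2] V)) : Prop :=
  ∀ (p : P) (u v : V), omegaV (f p u) (f p v) = omegaV u v

/-- The image of `L` under a local (symplectic) transformation. -/
def mapL (L : Submodule (ZMod 2) (QV P)) (f : P → (V ≃ₗ[ZMod 2] V)) :
    Submodule (ZMod 2) (QV P) :=
  Submodule.map (LinearEquiv.piCongrRight f : QV P ≃ₗ[ZMod 2] QV P).toLinearMap L

/-! ### Abstract group structures carried by subsets of a monoid -/

/-- The set `s` carries the structure of a solvable group. -/
structure SolvableGroupStructure (M : Type) [Monoid M] (s : Set M) where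
  G : Type
  [grp : Group G]
  solv : IsSolvable G
  f : G → M
  inj : Function.Injective f
  map_mul : ∀ a b : G, f (a * b) = f a * f b
  range_eq : Set.range f = s

/-- The quotient of the group (carried by) `A` by the normal subgroup (carried by) `Z`
is a compact solvable topological (Lie) group. -/
structure CompactSolvableQuotientStructure (M : Type) [Monoid M] [TopologicalSpace M]
    (A Z : Set M) where
  G : Type
  [grp : Group G]
  [top : TopologicalSpace G]
  [tgrp : IsTopologicalGroup G]
  cpt : CompactSpace G
  solv : IsSolvable G
  φ : M → G
  cont : ContinuousOn φ A
  map_mul' : ∀ a ∈ A, ∀ b ∈ A, φ (a * b) = φ a * φ b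
  surj : ∀ y : G, ∃ a ∈ A, φ a = y
  ker : ∀ a ∈ A, (φ a = 1 ↔ a ∈ Z)

/-! ### Logical qubits and transversally realisable gates -/

/-- The standard hermitian inner product on a finite-dimensional function space. -/
def innerF {ι : Type} [Fintype ι] (ψ φ : ι → ℂ) : ℂ := ∑ i, (starRingEnd ℂ) (ψ i) * φ i

/-- `e` is a unitary identification of the code space with a space of logical qubits. -/
def IsUnitaryEquiv (L : Submodule (ZMod 2) (QV P)) (σ : PauliSection L) {d : ℕ}
    (e : ↥(code L σ) ≃ₗ[ℂ] HP (Fin d)) : Prop :=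
  ∀ ψ φ : ↥(code L σ),
    innerF (e ψ) (e φ) = innerF (ψ : HP P) (φ : HP P)

/-- The operator acting as `w` on the logical qubit `k` and trivially elsewhere. -/
def oneQubitOp (d : ℕ) (k : Fin d) (w : Matrix (Fin 2) (Fin 2) ℂ) : MatP (Fin d) :=
  locOp fun j => if j = k then w else 1

/-- The set of rotations in `SO(3)` induced, via the identification `e`, on a fixed
logical qubit `k` by (exactly realised) transversal gates, i.e. by elements of `A(L, σ)`. -/
def logicalSet (L : Submodule (ZMod 2) (QV P)) (σ : PauliSection L) {d : ℕ}
    (e : ↥(code L σ) ≃ₗ[ℂ] HP (Fin d)) (k : Fin d) : Set Rot :=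
  {A | ∃ w ∈ Matrix.unitaryGroup (Fin 2) ℂ, adjRot w = A ∧
        ∃ u : P → Matrix (Fin 2) (Fin 2) ℂ,
          (∀ p, u p ∈ Matrix.unitaryGroup (Fin 2) ℂ) ∧
          ∀ φ : HP (Fin d),
            locOp u *ᵥ ((e.symm φ : HP P)) = ((e.symm (oneQubitOp d k w *ᵥ φ) : HP P))}

/-! ### Reed–Muller codes -/

/-- The qubit set `P = 𝔽₂^m ∖ {0}`. -/
abbrev RMQubits (m : ℕ) := {s : Fin m → ZMod 2 // s ≠ 0}

/-- Polynomial functions on `𝔽₂^m` of degree at most `r` with zero constant term. -/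
def RMspan (r m : ℕ) : Submodule (ZMod 2) ((Fin m → ZMod 2) → ZMod 2) :=
  Submodule.span (ZMod 2)
    {f | ∃ I : Finset (Fin m), I.Nonempty ∧ I.card ≤ r ∧ f = fun s => ∏ i ∈ I, s i}

/-- The shortened Reed–Muller code `R_*(r, m) ⊆ 𝔽₂^P`. -/
def RMstar (r m : ℕ) : Submodule (ZMod 2) (RMQubits m → ZMod 2) :=
  Submodule.map (LinearMap.funLeft (ZMod 2) (ZMod 2) Subtype.val) (RMspan r m)

/-- The `z`-part of a phase-space vector. -/
def zPart {P : Type} : QV P →ₗ[ZMod 2] (P → ZMod 2) where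
  toFun v := fun p => (v p).1
  map_add' := by intros; rfl
  map_smul' := by intros; rfl

/-- The `x`-part of a phase-space vector. -/
def xPart {P : Type} : QV P →ₗ[ZMod 2] (P → ZMod 2) where
  toFun v := fun p => (v p).2
  map_add' := by intros; rfl
  map_smul' := by intros; rfl

/-- The Calderbank–Shor–Steane isotropic subspace built from the shortened Reed–Muller
codes `R_*(m−2, m)` (in the `z`-coordinates) and `R_*(1, m)` (in the `x`-coordinates). -/
def cssL (m : ℕ) : Submodule (ZMod 2) (QV (RMQubits m)) :=
  Submodule.comap zPart (RMstar (m - 2) m) ⊓ Submodule.comap xPart (RMstar 1 m)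

/-- The stabilizer state `|0⟩_S ⊗ |0⟩_T + |0⟩_S ⊗ |1⟩_T + |1⟩_S ⊗ |0⟩_T − |1⟩_S ⊗ |1⟩_T`
(with `T = Sᶜ`), written in the computational basis. -/
def bellLike (S : Set P) (p q : P) : HP P := fun u =>
  if (∀ a ∈ S, u a = u p) ∧ (∀ a ∈ Sᶜ, u a = u q) then
    ((-1 : ℂ)) ^ ((u p : Fin 2).val * (u q : Fin 2).val) else 0


set_option linter.unusedSectionVars false

/-! ### Local operators -/

lemma locOp_mul (g h : P → Matrix (Fin 2) (Fin 2) ℂ) :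
    locOp (fun p => g p * h p) = locOp g * locOp h := by
  ext u w
  simp only [locOp, Matrix.mul_apply, Matrix.of_apply, Finset.prod_univ_sum,
    Fintype.piFinset_univ, Finset.prod_mul_distrib]

lemma locOp_one : locOp (fun _ : P => (1 : Matrix (Fin 2) (Fin 2) ℂ)) = 1 := by
  ext u w
  simp only [locOp, Matrix.of_apply, Matrix.one_apply, Finset.prod_ite_zero, Finset.prod_const_one,
    Finset.mem_univ, true_imp_iff, funext_iff]

/-- A local operator all of whose factors are monomial matrices acts as a monomial matrix. -/
lemma locOp_mulVec_of_monomial (g : P → Matrix (Fin 2) (Fin 2) ℂ) (c : P → Fin 2 → ℂ)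
    (τ : Fin 2 → Fin 2) (hg : ∀ p a b, g p a b = if b = τ a then c p a else 0)
    (ψ : HP P) (w : P → Fin 2) :
    (locOp g *ᵥ ψ) w = (∏ p, c p (w p)) * ψ (fun p => τ (w p)) := by
  simp only [Matrix.mulVec, dotProduct, locOp, Matrix.of_apply, hg, Finset.prod_ite_zero,
    Finset.mem_univ, true_imp_iff]
  rw [Finset.sum_eq_single (fun p => τ (w p))]
  · simp
  · intro b _ hb
    rw [if_neg (fun h => hb (funext h)), zero_mul]
  · simp

lemma locOp_diag_mulVec (c : P → Fin 2 → ℂ) (ψ : HP P) (w : P → Fin 2) :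
    (locOp (fun p => Matrix.diagonal (c p)) *ᵥ ψ) w = (∏ p, c p (w p)) * ψ w := by
  refine locOp_mulVec_of_monomial _ c id (fun p a b => ?_) ψ w
  simp only [Matrix.diagonal_apply, id, eq_comm]

lemma locOp_sigmaX_mulVec (ψ : HP P) (w : P → Fin 2) :
    (locOp (fun _ => sigmaX) *ᵥ ψ) w = ψ (w + 1) := by
  rw [locOp_mulVec_of_monomial _ (fun _ _ => 1) (fun a => a + 1) (fun p a b => ?_) ψ w]
  · simp only [Finset.prod_const_one, one_mul]
    rfl
  · fin_cases a <;> fin_cases b <;> simp [sigmaX]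

lemma locOp_mulVec_single (g : P → Matrix (Fin 2) (Fin 2) ℂ) (v w : P → Fin 2) :
    (locOp g *ᵥ Pi.single v 1) w = ∏ p, g p (w p) (v p) := by
  simp [locOp]

lemma Wop_zvec_add_zvec_mulVec {p q : P} (hpq : p ≠ q) (ψ : HP P) (w : P → Fin 2) :
    (Wop (zvec p + zvec q) *ᵥ ψ) w = if w p = w q then ψ w else -ψ w := by
  have hW : Wop (zvec p + zvec q) = locOp (fun s => Matrix.diagonal
      (fun a => (if s = p then (-1) ^ (a : ℕ) else 1) * (if s = q then (-1) ^ (a : ℕ) else 1))) := by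
    unfold Wop
    congr 1
    funext s
    have h01 : ((1 : ZMod 2)).val = 1 := rfl
    by_cases hp : s = p
    · subst hp
      ext a b
      fin_cases a <;> fin_cases b <;>
        simp [pauliMat, zvec, hpq, sigmaZ, h01]
    · by_cases hq : s = q
      · subst hq
        ext a b
        fin_cases a <;> fin_cases b <;>
          simp [pauliMat, zvec, hp, sigmaZ, h01]
      · ext a b
        fin_cases a <;> fin_cases b <;>
          simp [pauliMat, zvec, hp, hq]
  rw [hW, locOp_diag_mulVec]
  simp only [Finset.prod_mul_distrib, Finset.prod_ite_eq', Finset.mem_univ, if_true]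
  generalize w p = a
  generalize w q = b
  fin_cases a <;> fin_cases b <;> simp

lemma Wop_xsumOn_univ_mulVec (ψ : HP P) (w : P → Fin 2) :
    (Wop (xsumOn Set.univ) *ᵥ ψ) w = ψ (w + 1) := by
  have h01 : ((1 : ZMod 2)).val = 1 := rfl
  have hW : Wop (xsumOn (Set.univ : Set P)) = locOp (fun _ => sigmaX) := by
    simp [Wop, xsumOn, pauliMat, h01]
  rw [hW, locOp_sigmaX_mulVec]

/-! ### The two codes -/

/-- A vector fixed by the stabilizers of a spanning set lies in the code. -/
lemma mem_code_span {S : Set (QV P)} {L : Submodule (ZMod 2) (QV P)}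
    (hL : L = Submodule.span (ZMod 2) S) (σ : PauliSection L) (ψ : HP P) :
    ψ ∈ code L σ ↔ ∀ v ∈ S, σ.toFun v *ᵥ ψ = ψ := by
  subst hL
  refine ⟨fun h v hv => h v (Submodule.subset_span hv), fun h v hv => ?_⟩
  induction hv using Submodule.span_induction with
  | mem x hx => exact h x hx
  | zero => rw [σ.map_zero, Matrix.one_mulVec]
  | add x y hx hy hx' hy' =>
    rw [σ.mul_of_mem x hx y hy, ← Matrix.mulVec_mulVec, hy', hx']
  | smul a x hx hx' =>
    obtain rfl | rfl : a = 0 ∨ a = 1 := by revert a; decide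
    · rw [zero_smul, σ.map_zero, Matrix.one_mulVec]
    · rwa [one_smul]

/-- A vector is supported on the two constant labels `0⋯0` and `1⋯1`. -/
def ConstSupported (ψ : HP P) : Prop := ∀ w : P → Fin 2, ∀ p q, w p ≠ w q → ψ w = 0

lemma zpair_fixed_iff (ψ : HP P) {p q : P} (hpq : p ≠ q) :
    Wop (zvec p + zvec q) *ᵥ ψ = ψ ↔ ∀ w : P → Fin 2, w p ≠ w q → ψ w = 0 := by
  simp only [funext_iff, Wop_zvec_add_zvec_mulVec hpq]
  refine forall_congr' fun w => ?_
  split_ifs with h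
  · simp [h]
  · simp only [ne_eq, h, not_false_eq_true, forall_const]
    exact neg_eq_self

lemma zspan_fixed_iff (ψ : HP P) :
    (∀ v ∈ {w : QV P | ∃ a ∈ Set.univ, ∃ b ∈ Set.univ, a ≠ b ∧ w = zvec a + zvec b},
      Wop v *ᵥ ψ = ψ) ↔ ConstSupported ψ := by
  constructor
  · intro h w p q hw
    have hpq : p ≠ q := fun e => hw (by rw [e])
    exact (zpair_fixed_iff ψ hpq).1 (h _ ⟨p, trivial, q, trivial, hpq, rfl⟩) w hw
  · rintro h _ ⟨p, -, q, -, hpq, rfl⟩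
    exact (zpair_fixed_iff ψ hpq).2 fun w hw => h w p q hw

lemma mem_code_zspan {L : Submodule (ZMod 2) (QV P)} (hL : L = zspan Set.univ)
    (σ : PauliSection L) (hσ : StandardOn L σ) (ψ : HP P) :
    ψ ∈ code L σ ↔ ConstSupported ψ := by
  rw [mem_code_span hL σ, ← zspan_fixed_iff]
  refine forall₂_congr fun v hv => ?_
  rw [hσ v (hL ▸ Submodule.subset_span hv)]

lemma mem_code_ghz {L : Submodule (ZMod 2) (QV P)}
    (hL : L = zspan Set.univ ⊔ Submodule.span (ZMod 2) {xsumOn Set.univ})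
    (σ : PauliSection L) (hσ : StandardOn L σ) (ψ : HP P) :
    ψ ∈ code L σ ↔ ConstSupported ψ ∧ ∀ w, ψ (w + 1) = ψ w := by
  have hx : Wop (xsumOn Set.univ) *ᵥ ψ = ψ ↔ ∀ w, ψ (w + 1) = ψ w := by
    simp only [funext_iff, Wop_xsumOn_univ_mulVec]
  rw [zspan, ← Submodule.span_union] at hL
  rw [mem_code_span hL σ, ← zspan_fixed_iff, ← hx]
  have hσ' : ∀ v ∈ {w : QV P | ∃ a ∈ Set.univ, ∃ b ∈ Set.univ, a ≠ b ∧ w = zvec a + zvec b} ∪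
      {xsumOn Set.univ}, σ.toFun v = Wop v :=
    fun v hv => hσ v (hL ▸ Submodule.subset_span hv)
  constructor
  · intro h
    refine ⟨fun v hv => ?_, ?_⟩
    · rw [← hσ' v (Or.inl hv)]
      exact h v (Or.inl hv)
    · rw [← hσ' _ (Or.inr rfl)]
      exact h _ (Or.inr rfl)
  · rintro ⟨hz, hx⟩ v hv
    rw [hσ' v hv]
    rcases hv with hv | rfl
    · exact hz v hv
    · exact hx

lemma eq_const_of_forall_eq [Nonempty P] {w : P → Fin 2} (h : ∀ p q, w p = w q) :
    w = 0 ∨ w = 1 := by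
  obtain ⟨p⟩ := ‹Nonempty P›
  have hp : w p = 0 ∨ w p = 1 := by generalize w p = a; revert a; decide
  exact hp.imp (fun hp => funext fun q => (h q p).trans hp)
    (fun hp => funext fun q => (h q p).trans hp)

lemma constSupported_single_zero : ConstSupported (Pi.single 0 1 : HP P) := by
  intro w p q hw
  refine Pi.single_eq_of_ne ?_ _
  rintro rfl
  exact hw rfl

lemma constSupported_single_one : ConstSupported (Pi.single 1 1 : HP P) := by
  intro w p q hw
  refine Pi.single_eq_of_ne ?_ _
  rintro rfl
  exact hw rfl

lemma ConstSupported.add {ψ φ : HP P} (hψ : ConstSupported ψ) (hφ : ConstSupported φ) :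
    ConstSupported (ψ + φ) := fun w p q hw => by
  rw [Pi.add_apply, hψ w p q hw, hφ w p q hw, add_zero]

lemma ConstSupported.locOp_diag {ψ : HP P} (hψ : ConstSupported ψ) (c : P → Fin 2 → ℂ) :
    ConstSupported (locOp (fun p => Matrix.diagonal (c p)) *ᵥ ψ) := fun w p q hw => by
  rw [locOp_diag_mulVec, hψ w p q hw, mul_zero]

lemma ConstSupported.locOp_sigmaX {ψ : HP P} (hψ : ConstSupported ψ) :
    ConstSupported (locOp (fun _ => sigmaX) *ᵥ ψ) := fun w p q hw => by
  rw [locOp_sigmaX_mulVec]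
  exact hψ _ p q fun h => hw (add_right_cancel h)

/-! ### Rotations of monomial unitaries -/

lemma rotX_pi_mul_adj (M : Matrix (Fin 2) (Fin 2) ℂ) (i : Fin 3) :
    ((pauliBasis i * (sigmaX * M * sigmaXᴴ)).trace).re =
      ∑ k, rotX π i k * ((pauliBasis k * M).trace).re := by
  simp only [Matrix.trace_fin_two, Matrix.mul_apply, Fin.sum_univ_two, Fin.sum_univ_three]
  fin_cases i <;> simp [pauliBasis, sigmaX, sigmaY, sigmaZ, rotX]
  ring

lemma rotZ_mul_adj {c : Fin 2 → ℂ} {θ : ℝ} (h0 : starRingEnd ℂ (c 0) * c 0 = 1)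
    (h1 : starRingEnd ℂ (c 1) * c 1 = 1)
    (hθ : starRingEnd ℂ (c 0) * c 1 = Complex.exp (θ * Complex.I))
    (M : Matrix (Fin 2) (Fin 2) ℂ) (i : Fin 3) :
    ((pauliBasis i * (Matrix.diagonal c * M * (Matrix.diagonal c)ᴴ)).trace).re =
      ∑ k, rotZ θ i k * ((pauliBasis k * M).trace).re := by
  have hre := congrArg Complex.re hθ
  have him := congrArg Complex.im hθ
  have h0' := congrArg Complex.re h0
  have h1' := congrArg Complex.re h1
  simp only [Complex.exp_ofReal_mul_I_re, Complex.exp_ofReal_mul_I_im, Complex.mul_re,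
    Complex.mul_im, Complex.conj_re, Complex.conj_im, Complex.one_re] at hre him h0' h1'
  simp only [Matrix.trace_fin_two, Matrix.mul_apply, Fin.sum_univ_two, Fin.sum_univ_three]
  fin_cases i <;> simp [pauliBasis, sigmaX, sigmaY, sigmaZ, rotZ, ← hre, ← him]
  · ring
  · ring
  · linear_combination (M 0 0).re * h0' - (M 1 1).re * h1'

/-- If conjugation by `d` acts on the Pauli coordinates by `R`, then `adjRot (d * v)` is
`R * adjRot v`. -/
lemma adjRot_mul_of_adj {d : Matrix (Fin 2) (Fin 2) ℂ} {R : Rot}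
    (h : ∀ M i, ((pauliBasis i * (d * M * dᴴ)).trace).re =
      ∑ k, R i k * ((pauliBasis k * M).trace).re) (v : Matrix (Fin 2) (Fin 2) ℂ) :
    adjRot (d * v) = R * adjRot v := by
  ext i j
  have := h (v * pauliBasis j * vᴴ) i
  simp only [adjRot, Matrix.of_apply, Matrix.mul_apply (M := R), Matrix.conjTranspose_mul,
    Matrix.mul_assoc] at this ⊢
  rw [this, Finset.mul_sum]
  exact Finset.sum_congr rfl fun k _ => by ring

lemma adjRot_one : adjRot 1 = 1 := by
  ext i j
  fin_cases i <;> fin_cases j <;>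
    simp [adjRot, pauliBasis, sigmaX, sigmaY, sigmaZ, Matrix.trace_fin_two] <;> norm_num

lemma adjRot_sigmaX_mul (v : Matrix (Fin 2) (Fin 2) ℂ) :
    adjRot (sigmaX * v) = rotX π * adjRot v :=
  adjRot_mul_of_adj rotX_pi_mul_adj v

lemma sigmaX_mem_unitary : sigmaX ∈ Matrix.unitaryGroup (Fin 2) ℂ := by
  rw [Matrix.mem_unitaryGroup_iff]
  ext i j
  fin_cases i <;> fin_cases j <;> simp [sigmaX, Matrix.mul_apply, Matrix.star_apply]

lemma sigmaX_mul_sigmaX : sigmaX * sigmaX = 1 := by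
  ext i j
  fin_cases i <;> fin_cases j <;> simp [sigmaX]

/-- The diagonal lift `diag(1, e^{iθ})` of the rotation by `θ` about the `z`-axis. -/
def phase (θ : ℝ) : Fin 2 → ℂ := ![1, Complex.exp (θ * Complex.I)]

lemma conj_exp_mul_exp (θ : ℝ) :
    starRingEnd ℂ (Complex.exp (θ * Complex.I)) * Complex.exp (θ * Complex.I) = 1 := by
  rw [← Complex.normSq_eq_conj_mul_self, Complex.normSq_eq_norm_sq,
    Complex.norm_exp_ofReal_mul_I]
  simp

lemma adjRot_phase_mul (θ : ℝ) (v : Matrix (Fin 2) (Fin 2) ℂ) :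
    adjRot (Matrix.diagonal (phase θ) * v) = rotZ θ * adjRot v :=
  adjRot_mul_of_adj (rotZ_mul_adj (by simp [phase]) (conj_exp_mul_exp θ) (by simp [phase])) v

lemma phase_mem_unitary (θ : ℝ) :
    Matrix.diagonal (phase θ) ∈ Matrix.unitaryGroup (Fin 2) ℂ := by
  have := conj_exp_mul_exp θ
  rw [Matrix.mem_unitaryGroup_iff']
  ext i j
  fin_cases i <;> fin_cases j <;> simp [phase, Matrix.mul_apply, Matrix.star_apply, this]

lemma rotZ_eq_one_iff (θ : ℝ) : rotZ θ = 1 ↔ Complex.exp (θ * Complex.I) = 1 := by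
  rw [Complex.ext_iff, Complex.exp_ofReal_mul_I_re, Complex.exp_ofReal_mul_I_im]
  constructor
  · intro h
    exact ⟨by simpa [rotZ] using congrFun₂ h 0 0, by simpa [rotZ] using congrFun₂ h 1 0⟩
  · rintro ⟨h1, h2⟩
    simp only [Complex.one_re, Complex.one_im] at h1 h2
    ext i j
    fin_cases i <;> fin_cases j <;> simp [rotZ, h1, h2]

section Unitary

variable {u : Matrix (Fin 2) (Fin 2) ℂ}

lemma unitary_col (hu : u ∈ Matrix.unitaryGroup (Fin 2) ℂ) (a b : Fin 2) :
    starRingEnd ℂ (u 0 a) * u 0 b + starRingEnd ℂ (u 1 a) * u 1 b = if a = b then 1 else 0 := by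
  have := congrFun₂ (Matrix.mem_unitaryGroup_iff'.1 hu) a b
  simpa [Matrix.mul_apply, Fin.sum_univ_two, Matrix.one_apply] using this

lemma unitary_apply_zero_one (hu : u ∈ Matrix.unitaryGroup (Fin 2) ℂ) (h : u 1 0 = 0) :
    u 0 1 = 0 := by
  have h00 := unitary_col hu 0 0
  have h01 := unitary_col hu 0 1
  simp only [h, map_zero, zero_mul, add_zero, if_true, zero_ne_one, if_false] at h00 h01
  exact (mul_eq_zero.1 h01).resolve_left (left_ne_zero_of_mul_eq_one h00)

lemma unitary_exists_ne_zero (hu : u ∈ Matrix.unitaryGroup (Fin 2) ℂ) :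
    ∃ a, u a 0 ≠ 0 := by
  by_contra! h
  simpa [h] using unitary_col hu 0 0

/-- A unitary with vanishing lower-left entry is a lift of a rotation about the `z`-axis. -/
lemma unitary_diag_adjRot (hu : u ∈ Matrix.unitaryGroup (Fin 2) ℂ) (h : u 1 0 = 0) :
    ∃ θ : ℝ, adjRot u = rotZ θ ∧ u 0 0 * Complex.exp (θ * Complex.I) = u 1 1 := by
  have h' := unitary_apply_zero_one hu h
  have h00 : starRingEnd ℂ (u 0 0) * u 0 0 = 1 := by simpa [h] using unitary_col hu 0 0
  have h11 : starRingEnd ℂ (u 1 1) * u 1 1 = 1 := by simpa [h'] using unitary_col hu 1 1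
  have hnorm : ‖starRingEnd ℂ (u 0 0) * u 1 1‖ = 1 := by
    have aux : ∀ z : ℂ, starRingEnd ℂ z * z = 1 → ‖z‖ = 1 := fun z hz => by
      rw [← Complex.normSq_eq_conj_mul_self, Complex.normSq_eq_norm_sq] at hz
      have hz' : ‖z‖ ^ 2 = 1 := by exact_mod_cast hz
      exact (pow_eq_one_iff_of_nonneg (norm_nonneg z) two_ne_zero).1 hz'
    rw [norm_mul, RCLike.norm_conj, aux _ h00, aux _ h11, one_mul]
  obtain ⟨θ, hθ⟩ := (Complex.norm_eq_one_iff _).1 hnorm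
  refine ⟨θ, ?_, by rw [hθ]; linear_combination u 1 1 * h00⟩
  have hdiag : u = Matrix.diagonal (fun a => u a a) := by
    ext i j
    fin_cases i <;> fin_cases j <;> simp [h, h']
  have := adjRot_mul_of_adj (rotZ_mul_adj (c := fun a => u a a) h00 h11 hθ.symm) 1
  rwa [mul_one, adjRot_one, mul_one, ← hdiag] at this

end Unitary

/-! ### Automorphisms -/

lemma one_mem_autSet (L : Submodule (ZMod 2) (QV P)) (σ : PauliSection L) :
    1 ∈ autSet L σ :=
  ⟨fun _ => 1, fun _ => one_mem _, fun _ => adjRot_one, fun ψ hψ => by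
    rwa [locOp_one, Matrix.one_mulVec]⟩

lemma mul_mem_autSet {L : Submodule (ZMod 2) (QV P)} {σ : PauliSection L} {g h : P → Rot}
    {d : P → Matrix (Fin 2) (Fin 2) ℂ} (hd : ∀ p, d p ∈ Matrix.unitaryGroup (Fin 2) ℂ)
    (hdh : ∀ p v, adjRot (d p * v) = h p * adjRot v)
    (hcode : ∀ ψ ∈ code L σ, locOp d *ᵥ ψ ∈ code L σ) (hg : g ∈ autSet L σ) :
    h * g ∈ autSet L σ := by
  obtain ⟨u, hu, hug, huc⟩ := hg
  refine ⟨fun p => d p * u p, fun p => mul_mem (hd p) (hu p), fun p => ?_, fun ψ hψ => ?_⟩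
  · rw [hdh, hug, Pi.mul_apply]
  · rw [locOp_mul, ← Matrix.mulVec_mulVec]
    exact hcode _ (huc ψ hψ)

/-- The simultaneous `x`-flip lifted to `sigmaX`, applied to an automorphism. -/
lemma rotX_mul_mem_autSet {L : Submodule (ZMod 2) (QV P)} {σ : PauliSection L} {g : P → Rot}
    (hcode : ∀ ψ ∈ code L σ, locOp (fun _ => sigmaX) *ᵥ ψ ∈ code L σ) (hg : g ∈ autSet L σ) :
    (fun _ => rotX π) * g ∈ autSet L σ :=
  mul_mem_autSet (fun _ => sigmaX_mem_unitary) (fun _ => adjRot_sigmaX_mul) hcode hg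

lemma rotZ_mul_mem_autSet {L : Submodule (ZMod 2) (QV P)} {σ : PauliSection L} {g : P → Rot}
    {θ : P → ℝ}
    (hcode : ∀ ψ ∈ code L σ, locOp (fun p => Matrix.diagonal (phase (θ p))) *ᵥ ψ ∈ code L σ)
    (hg : g ∈ autSet L σ) : (fun p => rotZ (θ p)) * g ∈ autSet L σ :=
  mul_mem_autSet (fun p => phase_mem_unitary (θ p)) (fun p => adjRot_phase_mul (θ p)) hcode hg

lemma diag_or_antidiag [Nontrivial P] {u : P → Matrix (Fin 2) (Fin 2) ℂ}
    (hu : ∀ p, u p ∈ Matrix.unitaryGroup (Fin 2) ℂ)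
    (h : ∀ p q, p ≠ q → u p 0 0 * u q 1 0 = 0) :
    (∀ p, u p 1 0 = 0) ∨ ∀ p, u p 0 0 = 0 := by
  by_contra! hne
  obtain ⟨⟨q, hq⟩, r, hr⟩ := hne
  have hoff : ∀ p, p ≠ q → u p 0 0 = 0 := fun p hp =>
    (mul_eq_zero.1 (h p q hp)).resolve_right hq
  obtain ⟨p, hp⟩ := exists_ne q
  have hp1 : u p 1 0 ≠ 0 := fun hp1 => by
    obtain ⟨a, ha⟩ := unitary_exists_ne_zero (hu p)
    fin_cases a
    · exact ha (hoff p hp)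
    · exact ha hp1
  have hq0 : u q 0 0 = 0 := (mul_eq_zero.1 (h q p hp.symm)).resolve_right hp1
  by_cases hrq : r = q
  · exact hr (hrq ▸ hq0)
  · exact hr (hoff r hrq)

/-- If the product over `T` of the first columns of `u` vanishes on all labels that differ in a
prescribed way at `p` and `q`, the factors at `p` and `q` are complementary. -/
lemma pair_mul_eq_zero {u : P → Matrix (Fin 2) (Fin 2) ℂ}
    (hu : ∀ p, u p ∈ Matrix.unitaryGroup (Fin 2) ℂ) {p q : P} (hpq : p ≠ q) {T : Finset P}
    (h : ∀ w : P → Fin 2, w p = 0 → w q = 1 → ∏ s ∈ T, u s (w s) 0 = 0) :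
    u p 0 0 * u q 1 0 = 0 := by
  by_contra hne
  obtain ⟨hp, hq⟩ := mul_ne_zero_iff.1 hne
  choose a ha using fun s => unitary_exists_ne_zero (hu s)
  refine Finset.prod_ne_zero_iff.2 (fun s _ => ?_)
    (h (Function.update (Function.update a p 0) q 1) (by simp [hpq]) (by simp))
  by_cases hsq : s = q
  · subst hsq
    simpa using hq
  · by_cases hsp : s = p
    · subst hsp
      simpa [hsq] using hp
    · simpa [hsq, hsp] using ha s

/-- If `u` sends `|0⋯0⟩` to a vector supported on constant labels, its factors are
complementary. -/
lemma pair_mul_eq_zero_of_zero {u : P → Matrix (Fin 2) (Fin 2) ℂ}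
    (hu : ∀ p, u p ∈ Matrix.unitaryGroup (Fin 2) ℂ)
    (h : ConstSupported (locOp u *ᵥ Pi.single 0 1)) (p q : P) (hpq : p ≠ q) :
    u p 0 0 * u q 1 0 = 0 :=
  pair_mul_eq_zero hu hpq (T := Finset.univ) fun w hp hq => by
    simpa [locOp_mulVec_single] using h w p q (by simp [hp, hq])

/-- If `u` sends `|0⋯0⟩ + |1⋯1⟩` to a vector supported on constant labels and there are at
least three qubits, its factors are complementary: contract a third qubit with the conjugate
of the first column of `u` there. -/
lemma pair_mul_eq_zero_of_ghz (hP : 3 ≤ Fintype.card P)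
    {u : P → Matrix (Fin 2) (Fin 2) ℂ} (hu : ∀ p, u p ∈ Matrix.unitaryGroup (Fin 2) ℂ)
    (h : ConstSupported (locOp u *ᵥ (Pi.single 0 1 + Pi.single 1 1))) (p q : P) (hpq : p ≠ q) :
    u p 0 0 * u q 1 0 = 0 := by
  obtain ⟨r, -, hr⟩ : ∃ r ∈ (Finset.univ : Finset P), r ∉ ({p, q} : Finset P) :=
    Finset.exists_mem_notMem_of_card_lt_card (by
      rw [Finset.card_univ]
      exact (Finset.card_le_two).trans_lt hP)
  simp only [Finset.mem_insert, Finset.mem_singleton, not_or] at hr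
  refine pair_mul_eq_zero hu hpq (T := Finset.univ.erase r) fun w hp hq => ?_
  have key : ∀ a : Fin 2, u r a 0 * (∏ s ∈ Finset.univ.erase r, u s (w s) 0) +
      u r a 1 * ∏ s ∈ Finset.univ.erase r, u s (w s) 1 = 0 := fun a => by
    have hw := h (Function.update w r a) p q (by
      simp [Ne.symm hr.1, Ne.symm hr.2, hp, hq])
    have hprod : ∀ b, ∏ s, u s (Function.update w r a s) b =
        u r a b * ∏ s ∈ Finset.univ.erase r, u s (w s) b := fun b => by
      rw [← Finset.mul_prod_erase _ _ (Finset.mem_univ r), Function.update_self]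
      congr 1
      refine Finset.prod_congr rfl fun s hs => ?_
      rw [Function.update_of_ne (Finset.ne_of_mem_erase hs)]
    rw [Matrix.mulVec_add, Pi.add_apply, locOp_mulVec_single, locOp_mulVec_single] at hw
    simp only [Pi.zero_apply, Pi.one_apply] at hw
    rwa [hprod, hprod] at hw
  have h00 := unitary_col (hu r) 0 0
  have h01 := unitary_col (hu r) 0 1
  simp only [if_true, zero_ne_one, if_false] at h00 h01
  linear_combination starRingEnd ℂ (u r 0 0) * key 0 + starRingEnd ℂ (u r 1 0) * key 1
    - (∏ s ∈ Finset.univ.erase r, u s (w s) 0) * h00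
    - (∏ s ∈ Finset.univ.erase r, u s (w s) 1) * h01

/-- Local unitaries with vanishing lower-left entries induce rotations about the `z`-axis whose
angles sum to a full turn if the products of the two diagonals agree. -/
lemma diag_lift_angles {u : P → Matrix (Fin 2) (Fin 2) ℂ}
    (hu : ∀ p, u p ∈ Matrix.unitaryGroup (Fin 2) ℂ) (h : ∀ p, u p 1 0 = 0) :
    ∃ θ : P → ℝ, (∀ p, adjRot (u p) = rotZ (θ p)) ∧
      (∏ p, u p 0 0 = ∏ p, u p 1 1 → rotZ (∑ p, θ p) = 1) := by
  choose θ hθ hexp using fun p => unitary_diag_adjRot (hu p) (h p)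
  refine ⟨θ, hθ, fun hprod => ?_⟩
  have hne : ∏ p, u p 0 0 ≠ 0 := Finset.prod_ne_zero_iff.2 fun p _ h0 => by
    simpa [h0, h p] using unitary_col (hu p) 0 0
  rw [rotZ_eq_one_iff]
  push_cast
  rw [Finset.sum_mul, Complex.exp_sum]
  refine mul_left_cancel₀ hne ?_
  rw [← Finset.prod_mul_distrib, Finset.prod_congr rfl fun p _ => hexp p, mul_one, hprod]

/-- The rotations of an antidiagonal family of unitaries are `x`-flips of those of a diagonal
family. -/
lemma antidiag_lift_angles {u : P → Matrix (Fin 2) (Fin 2) ℂ}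
    (hu : ∀ p, u p ∈ Matrix.unitaryGroup (Fin 2) ℂ) (h : ∀ p, u p 0 0 = 0) :
    ∃ θ : P → ℝ, (∀ p, adjRot (u p) = rotX π * rotZ (θ p)) ∧
      (∏ p, u p 1 0 = ∏ p, u p 0 1 → rotZ (∑ p, θ p) = 1) := by
  obtain ⟨θ, hθ, hsum⟩ := diag_lift_angles (u := fun p => sigmaX * u p)
    (fun p => mul_mem sigmaX_mem_unitary (hu p)) (fun p => by simp [sigmaX, Matrix.mul_apply, h p])
  refine ⟨θ, fun p => ?_, fun hprod => hsum (by simpa [sigmaX, Matrix.mul_apply] using hprod)⟩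
  rw [← hθ, ← adjRot_sigmaX_mul, ← mul_assoc, sigmaX_mul_sigmaX, one_mul]

lemma autSet_zspan (hP : 2 ≤ Fintype.card P) {L : Submodule (ZMod 2) (QV P)}
    (hL : L = zspan Set.univ) (σ : PauliSection L) (hσ : StandardOn L σ) :
    autSet L σ = ↑(Submonoid.closure
      (({fun _ => rotX π} : Set (P → Rot)) ∪ {g | ∀ p, g p ∈ Cz})) := by
  have : Nontrivial P := Fintype.one_lt_card_iff_nontrivial.1 hP
  have hmem := mem_code_zspan hL σ hσ
  ext g
  constructor
  · rintro ⟨u, hu, hug, huc⟩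
    have himg := (hmem _).1 (huc _ ((hmem _).2 constSupported_single_zero))
    rcases diag_or_antidiag hu (pair_mul_eq_zero_of_zero hu himg) with h | h
    · obtain ⟨θ, hθ, -⟩ := diag_lift_angles hu h
      exact Submonoid.subset_closure (Or.inr fun p => ⟨θ p, by rw [← hθ, hug]⟩)
    · obtain ⟨θ, hθ, -⟩ := antidiag_lift_angles hu h
      have hg : g = (fun _ => rotX π) * fun p => rotZ (θ p) :=
        funext fun p => by rw [← hug, hθ, Pi.mul_apply]
      rw [hg]
      exact mul_mem (Submonoid.subset_closure (Or.inl rfl))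
        (Submonoid.subset_closure (Or.inr fun p => ⟨θ p, rfl⟩))
  · intro hg
    induction hg using Submonoid.closure_induction_left with
    | one => exact one_mem_autSet L σ
    | mul_left x hx y _ hy =>
      rcases hx with rfl | hx
      · exact rotX_mul_mem_autSet
          (fun ψ hψ => (hmem _).2 ((hmem _).1 hψ).locOp_sigmaX) hy
      · choose θ hθ using hx
        obtain rfl : (fun p => rotZ (θ p)) = x := funext hθ
        exact rotZ_mul_mem_autSet
          (fun ψ hψ => (hmem _).2 (((hmem _).1 hψ).locOp_diag _)) hy

lemma autSet_ghz (hP : 3 ≤ Fintype.card P) {L : Submodule (ZMod 2) (QV P)}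
    (hL : L = zspan Set.univ ⊔ Submodule.span (ZMod 2) {xsumOn Set.univ})
    (σ : PauliSection L) (hσ : StandardOn L σ) :
    autSet L σ = ↑(Submonoid.closure
      (({fun _ => rotX π} : Set (P → Rot)) ∪
        {g | ∃ θ : P → ℝ, (∀ p, g p = rotZ (θ p)) ∧ rotZ (∑ p, θ p) = 1})) := by
  have : Nontrivial P := Fintype.one_lt_card_iff_nontrivial.1 (by omega)
  have hmem := mem_code_ghz hL σ hσ
  have h11 : (1 + 1 : P → Fin 2) = 0 := rfl
  have h10 : (1 : P → Fin 2) ≠ 0 := fun h =>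
    one_ne_zero (congrFun h (Classical.arbitrary P))
  -- on constantly supported vectors, flip invariance only concerns the two constant labels
  have hflip : ∀ ψ : HP P, ConstSupported ψ → ψ 1 = ψ 0 → ∀ w, ψ (w + 1) = ψ w := by
    intro ψ hψ h w
    by_cases hw : ∀ p q, w p = w q
    · rcases eq_const_of_forall_eq hw with rfl | rfl
      · rw [zero_add, h]
      · rw [h11, h]
    · push Not at hw
      obtain ⟨p, q, hw⟩ := hw
      rw [hψ w p q hw, hψ (w + 1) p q fun h => hw (add_right_cancel h)]
  ext g
  constructor
  · rintro ⟨u, hu, hug, huc⟩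
    have hghz : (Pi.single 0 1 + Pi.single 1 1 : HP P) ∈ code L σ := by
      have hc := (constSupported_single_zero (P := P)).add constSupported_single_one
      exact (hmem _).2 ⟨hc, hflip _ hc (by simp [h10, h10.symm])⟩
    obtain ⟨himg, hinv⟩ := (hmem _).1 (huc _ hghz)
    have hprod := hinv 0
    simp only [zero_add, Matrix.mulVec_add, Pi.add_apply, locOp_mulVec_single, Pi.zero_apply,
      Pi.one_apply] at hprod
    have hzero : ∀ {f : P → ℂ}, (∀ p, f p = 0) → ∏ p, f p = 0 := fun {f} hf =>
      Finset.prod_eq_zero (Finset.mem_univ (Classical.arbitrary P)) (hf _)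
    rcases diag_or_antidiag hu (pair_mul_eq_zero_of_ghz hP hu himg) with h | h
    · obtain ⟨θ, hθ, hsum⟩ := diag_lift_angles hu h
      refine Submonoid.subset_closure (Or.inr ⟨θ, fun p => by rw [← hθ, hug], hsum ?_⟩)
      rw [hzero h, hzero fun p => unitary_apply_zero_one (hu p) (h p), zero_add, add_zero] at hprod
      exact hprod.symm
    · obtain ⟨θ, hθ, hsum⟩ := antidiag_lift_angles hu h
      have hg : g = (fun _ => rotX π) * fun p => rotZ (θ p) :=
        funext fun p => by rw [← hug, hθ, Pi.mul_apply]
      have hlast : ∀ p, u p 1 1 = 0 := fun p => by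
        simpa [sigmaX, Matrix.mul_apply] using
          unitary_apply_zero_one (mul_mem sigmaX_mem_unitary (hu p))
            (by simp [sigmaX, Matrix.mul_apply, h p])
      rw [hzero h, hzero hlast, zero_add, add_zero] at hprod
      rw [hg]
      exact mul_mem (Submonoid.subset_closure (Or.inl rfl))
        (Submonoid.subset_closure (Or.inr ⟨θ, fun _ => rfl, hsum hprod⟩))
  · intro hg
    induction hg using Submonoid.closure_induction_left with
    | one => exact one_mem_autSet L σ
    | mul_left x hx y _ hy =>
      rcases hx with rfl | ⟨θ, hθ, hsum⟩
      · refine rotX_mul_mem_autSet (fun ψ hψ => ?_) hy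
        obtain ⟨hc, hinv⟩ := (hmem _).1 hψ
        refine (hmem _).2 ⟨hc.locOp_sigmaX, fun w => ?_⟩
        rw [locOp_sigmaX_mulVec, locOp_sigmaX_mulVec, hinv]
      · obtain rfl : x = fun p => rotZ (θ p) := funext hθ
        refine rotZ_mul_mem_autSet (fun ψ hψ => ?_) hy
        obtain ⟨hc, hinv⟩ := (hmem _).1 hψ
        refine (hmem _).2 ⟨hc.locOp_diag _, hflip _ (hc.locOp_diag _) ?_⟩
        have hexp : ∏ p, Complex.exp (θ p * Complex.I) = 1 := by
          rw [rotZ_eq_one_iff] at hsum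
          rw [← Complex.exp_sum, ← Finset.sum_mul, ← hsum]
          push_cast
          rfl
        have h0 := hinv 0
        rw [zero_add] at h0
        rw [locOp_diag_mulVec, locOp_diag_mulVec]
        simp [phase, hexp, h0]

/-- **GHZ states and the two-dimensional `z`-difference code.** Let `|P| ≥ 3`. For the
GHZ Lagrangian `L = ⟨z_p + z_q : p ≠ q⟩ + ⟨Σ_s x_s⟩` with standard section, the full
automorphism group is generated by the simultaneous rotation by `180°` about each `x`
axis together with the torus `{(g_s) ∈ (C_z)^P : Π_s g_s = 1}`; for
`L' = ⟨z_p + z_q : p ≠ q⟩` with standard section, it is generated by the simultaneous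
`x`-flip together with the full torus `(C_z)^P`. -/
theorem ghz_automorphisms {P : Type} [Fintype P] [DecidableEq P]
    (hP : 3 ≤ Fintype.card P)
    (L L' : Submodule (ZMod 2) (QV P))
    (hL : L = zspan Set.univ ⊔ Submodule.span (ZMod 2) {xsumOn Set.univ})
    (hL' : L' = zspan Set.univ)
    (σ : PauliSection L) (hσ : StandardOn L σ)
    (σ' : PauliSection L') (hσ' : StandardOn L' σ') :
    autSet L σ = ↑(Submonoid.closure
        (({fun _ => rotX π} : Set (P → Rot)) ∪
          {g | ∃ θ : P → ℝ, (∀ p, g p = rotZ (θ p)) ∧ rotZ (∑ p, θ p) = 1})) ∧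
    autSet L' σ' = ↑(Submonoid.closure
        (({fun _ => rotX π} : Set (P → Rot)) ∪ {g | ∀ p, g p ∈ Cz})) :=
  ⟨autSet_ghz hP hL σ hσ, autSet_zspan (by omega) hL' σ' hσ'⟩

end Stab
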